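/- Let G be a virtually poly-ℤ group, i.e. G contains a poly-ℤ subgroup of finite index. Then G has property (A): for every automorphism φ of G, every element g ∈ G of infinite order, and all integers a, b with φ(g^a) = g^b, one has a = b or a = −b. -/

import Mathlib

/-- A poly-ℤ chain of length `n` for a group `G`: a chain
`{1} = c 0 ⊆ c 1 ⊆ … ⊆ c n = G` of subgroups such that each `c i` is normal in
`c (i+1)` with infinite cyclic quotient (expressed by the existence of a surjection
of `c (i+1)` onto `ℤ` with kernel `c i`). -/
def IsPolyZChain {G : Type*} [Group G] {n : ℕ} (c : Fin (n + 1) → Subgroup G) : Prop :=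
  c 0 = ⊥ ∧ c (Fin.last n) = ⊤ ∧
  ∀ i : Fin n, c i.castSucc ≤ c i.succ ∧
    ∃ f : (c i.succ) →* Multiplicative ℤ, Function.Surjective f ∧
      f.ker = (c i.castSucc).subgroupOf (c i.succ)

/-- A group is poly-ℤ if it admits a poly-ℤ chain of some length. -/
def IsPolyZ (G : Type*) [Group G] : Prop :=
  ∃ n : ℕ, ∃ c : Fin (n + 1) → Subgroup G, IsPolyZChain c

/-- A group is virtually poly-ℤ if it contains a poly-ℤ subgroup of finite index. -/
def IsVirtuallyPolyZ (G : Type*) [Group G] : Prop :=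
  ∃ H : Subgroup G, H.FiniteIndex ∧ IsPolyZ H

/-- Every power of an element of infinite order can be detected modulo a finite-index subgroup:
for each `m ≠ 0` some finite-index subgroup contains only those powers of `g` whose exponent is
divisible by `m`. -/
def SeparatesPowers (G : Type*) [Group G] : Prop :=
  ∀ g : G, ¬ IsOfFinOrder g → ∀ m : ℕ, m ≠ 0 →
    ∃ N : Subgroup G, N.FiniteIndex ∧ ∀ n : ℤ, g ^ n ∈ N → (m : ℤ) ∣ n

theorem Group.FG.finite_monoidHom (G Q : Type*) [Group G] [Group.FG G] [Group Q] [Finite Q] :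
    Finite (G →* Q) := by
  obtain ⟨S, hS, hfin⟩ := Group.fg_iff.mp (inferInstance : Group.FG G)
  have := hfin.to_subtype
  refine Finite.of_injective (fun (f : G →* Q) (s : S) => f s) fun f f' h => ?_
  exact MonoidHom.eq_of_eqOn_dense hS fun s hs => congrFun h ⟨s, hs⟩

theorem Subgroup.exists_characteristic_finiteIndex_le {G : Type*} [Group G] [Group.FG G]
    (N : Subgroup G) [N.FiniteIndex] :
    ∃ K : Subgroup G, K.Characteristic ∧ K.FiniteIndex ∧ K ≤ N := by
  let Q := G ⧸ N.normalCore
  have := Group.FG.finite_monoidHom G Q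
  let F : G →* ((G →* Q) → Q) := MonoidHom.pi fun f => f
  have hF (x : G) : x ∈ F.ker ↔ ∀ f : G →* Q, f x = 1 := by
    rw [MonoidHom.mem_ker, funext_iff]
    rfl
  refine ⟨F.ker, ?_, inferInstance, fun x hx => ?_⟩
  · rw [Subgroup.characteristic_iff_le_comap]
    intro φ x hx
    rw [Subgroup.mem_comap, hF]
    exact fun f => (hF x).mp hx (f.comp φ.toMonoidHom)
  · have h := (hF x).mp hx (QuotientGroup.mk' N.normalCore)
    exact N.normalCore_le ((QuotientGroup.eq_one_iff x).mp h)

theorem Subgroup.FiniteIndex.map_subtype {G : Type*} [Group G] {H : Subgroup G} [H.FiniteIndex]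
    (N : Subgroup H) [N.FiniteIndex] : (N.map H.subtype).FiniteIndex := by
  rw [Subgroup.finiteIndex_iff, Subgroup.index_map_subtype]
  exact mul_ne_zero Subgroup.FiniteIndex.index_ne_zero Subgroup.FiniteIndex.index_ne_zero

theorem Group.FG.of_finiteIndex {G : Type*} [Group G] (H : Subgroup G) [H.FiniteIndex]
    [Group.FG H] : Group.FG G := by
  let R : Subgroup G := Subgroup.closure (Set.range (Quotient.out : G ⧸ H → G))
  have : Finite (G ⧸ H) := inferInstance
  have hR : R.FG := (Subgroup.fg_iff R).mpr ⟨_, rfl, Set.finite_range (ι := G ⧸ H) _⟩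
  rw [Group.fg_def]
  convert hR.sup ((Group.fg_iff_subgroup_fg H).mp inferInstance)
  refine (eq_top_iff.mpr fun x _ => ?_).symm
  have h : (Quotient.out (x : G ⧸ H))⁻¹ * x ∈ H :=
    QuotientGroup.eq.mp (QuotientGroup.out_eq' (x : G ⧸ H))
  simpa using Subgroup.mul_mem_sup (S := R) (T := H)
    (Subgroup.subset_closure (Set.mem_range_self (x : G ⧸ H))) h

theorem SeparatesPowers.of_finiteIndex {G : Type*} [Group G] (H : Subgroup G) [H.FiniteIndex]
    (hH : SeparatesPowers H) : SeparatesPowers G := by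
  intro g hg m hm
  obtain ⟨j, hj, -, hjH⟩ :=
    Subgroup.exists_pow_mem_of_index_ne_zero (H := H) Subgroup.FiniteIndex.index_ne_zero g
  have hinf : ¬ IsOfFinOrder (⟨g ^ j, hjH⟩ : H) := by
    rw [← Submonoid.isOfFinOrder_coe]
    exact fun h => hg (h.of_pow hj.ne')
  obtain ⟨N, hN, hNdvd⟩ := hH _ hinf m hm
  refine ⟨N.map H.subtype, Subgroup.FiniteIndex.map_subtype N, fun n hn => hNdvd n ?_⟩
  rw [← Subgroup.mem_map_iff_mem H.subtype_injective]
  have h : (g ^ n) ^ j ∈ N.map H.subtype := pow_mem hn j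
  simpa [← zpow_natCast, ← zpow_mul, mul_comm] using h

theorem Subgroup.finiteIndex_of_sup_eq_top {G : Type*} [Group G] (N L : Subgroup G) [N.Normal]
    (h : N ⊔ L = ⊤) [(L.subgroupOf N).FiniteIndex] : L.FiniteIndex := by
  let q : N ⧸ L.subgroupOf N → G ⧸ L :=
    Quotient.map' (fun x : N => (x : G)) fun x y hxy => by
      rw [QuotientGroup.leftRel_apply] at hxy ⊢
      exact hxy
  have hq : Function.Surjective q := by
    intro x
    induction x using QuotientGroup.induction_on with
    | H x =>
      obtain ⟨y, hy, z, hz, rfl⟩ :=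
        Subgroup.mem_sup_of_normal_left.mp (h ▸ Subgroup.mem_top x : x ∈ N ⊔ L)
      refine ⟨((⟨y, hy⟩ : N) : N ⧸ L.subgroupOf N), ?_⟩
      exact QuotientGroup.eq.mpr (by simpa using hz)
  have := Finite.of_surjective q hq
  exact Subgroup.finiteIndex_of_finite_quotient

theorem MonoidHom.ker_sup_zpowers_eq_top {G : Type*} [Group G] (f : G →* Multiplicative ℤ) {t : G}
    (ht : f t = Multiplicative.ofAdd 1) : f.ker ⊔ Subgroup.zpowers t = ⊤ := by
  refine eq_top_iff.mpr fun x _ => ?_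
  have hx : x * (t ^ (f x).toAdd)⁻¹ ∈ f.ker := by
    rw [MonoidHom.mem_ker, map_mul, map_inv, map_zpow, ht, ← ofAdd_zsmul]
    simp
  simpa using Subgroup.mul_mem_sup hx
    (Subgroup.zpow_mem _ (Subgroup.mem_zpowers t) (f x).toAdd)

theorem Group.FG.of_ker_int {G : Type*} [Group G] (f : G →* Multiplicative ℤ)
    (hf : Function.Surjective f) [Group.FG f.ker] : Group.FG G := by
  obtain ⟨t, ht⟩ := hf (Multiplicative.ofAdd 1)
  rw [Group.fg_def, ← f.ker_sup_zpowers_eq_top ht]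
  refine ((Group.fg_iff_subgroup_fg _).mp inferInstance).sup ?_
  rw [Subgroup.zpowers_eq_closure]
  exact (Subgroup.fg_iff _).mpr ⟨_, rfl, Set.finite_singleton t⟩

theorem SeparatesPowers.of_ker_int {G : Type*} [Group G] (f : G →* Multiplicative ℤ)
    (hf : Function.Surjective f) [Group.FG f.ker] (hker : SeparatesPowers f.ker) :
    SeparatesPowers G := by
  intro g hg m hm
  obtain ⟨t, ht⟩ := hf (Multiplicative.ofAdd 1)
  by_cases hgk : g ∈ f.ker
  · have hinf : ¬ IsOfFinOrder (⟨g, hgk⟩ : f.ker) := by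
      rwa [← Submonoid.isOfFinOrder_coe]
    obtain ⟨N, hN, hNdvd⟩ := hker _ hinf m hm
    obtain ⟨K, hK, hKfin, hKN⟩ := N.exists_characteristic_finiteIndex_le
    let K' : Subgroup G := K.map f.ker.subtype
    have hK' : K'.Normal := inferInstance
    let L : Subgroup G := K' ⊔ Subgroup.zpowers t
    have hKL : K ≤ L.subgroupOf f.ker := fun x hx =>
      Subgroup.mem_sup_left (Subgroup.mem_map_of_mem f.ker.subtype hx)
    have : (L.subgroupOf f.ker).FiniteIndex := Subgroup.finiteIndex_of_le hKL
    have hL : L.FiniteIndex := by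
      refine Subgroup.finiteIndex_of_sup_eq_top f.ker L (top_le_iff.mp ?_)
      rw [← f.ker_sup_zpowers_eq_top ht]
      exact sup_le_sup_left le_sup_right _
    refine ⟨L, hL, fun n hn => hNdvd n (hKN ?_)⟩
    obtain ⟨y, hy, z, ⟨i, rfl⟩, hyz⟩ := Subgroup.mem_sup_of_normal_left.mp hn
    obtain ⟨k, hk, rfl⟩ := hy
    have hi : i = 0 := by
      have h := congrArg f hyz
      have hk1 : f (k : G) = 1 := k.2
      have hg1 : f g = 1 := hgk
      simp only [map_mul, map_zpow, Subgroup.coe_subtype, hk1, hg1, ht, one_mul, one_zpow] at h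
      rw [← ofAdd_zsmul] at h
      simpa using h
    subst hi
    have : (⟨g, hgk⟩ : f.ker) ^ n = k := by
      ext
      simpa using hyz.symm
    rwa [this]
  · have hd : (f g).toAdd ≠ 0 := hgk
    let d : ℤ := (f g).toAdd
    let π : G →* Multiplicative (ZMod (m * d.natAbs)) :=
      (AddMonoidHom.toMultiplicative (Int.castAddHom (ZMod (m * d.natAbs)))).comp f
    have : NeZero (m * d.natAbs) := ⟨mul_ne_zero hm (Int.natAbs_ne_zero.mpr hd)⟩
    have : Finite (Multiplicative (ZMod (m * d.natAbs))) :=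
      inferInstanceAs (Finite (ZMod (m * d.natAbs)))
    refine ⟨π.ker, inferInstance, fun n hn => ?_⟩
    have h : ((n * d : ℤ) : ZMod (m * d.natAbs)) = 0 := by
      have h1 : π (g ^ n) = 1 := hn
      have h2 : π (g ^ n) = Multiplicative.ofAdd ((n * d : ℤ) : ZMod (m * d.natAbs)) := by
        simp [π, d, AddMonoidHom.toMultiplicative]
      rw [h2] at h1
      exact h1
    rw [ZMod.intCast_zmod_eq_zero_iff_dvd, Nat.cast_mul, Int.natCast_natAbs] at h
    have h' : (m : ℤ) * d ∣ n * d := by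
      rwa [← abs_dvd, abs_mul, Nat.abs_cast]
    exact Int.dvd_of_mul_dvd_mul_right hd h'

theorem SeparatesPowers.of_mulEquiv {G H : Type*} [Group G] [Group H] (e : G ≃* H)
    (hG : SeparatesPowers G) : SeparatesPowers H := by
  intro h hh m hm
  have hinf : ¬ IsOfFinOrder (e.symm h) := by
    rwa [← e.injective.isOfFinOrder_iff (f := e.toMonoidHom), MulEquiv.toMonoidHom_eq_coe,
      MonoidHom.coe_coe, e.apply_symm_apply]
  obtain ⟨N, hN, hNdvd⟩ := hG _ hinf m hm
  have hfin : (N.comap e.symm.toMonoidHom).FiniteIndex := by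
    rw [Subgroup.finiteIndex_iff, Subgroup.index_comap_of_surjective N e.symm.surjective]
    exact hN.index_ne_zero
  refine ⟨N.comap e.symm.toMonoidHom, hfin, fun n hn => hNdvd n ?_⟩
  simpa using hn

theorem IsPolyZ.fg_and_separatesPowers {G : Type*} [Group G] (hG : IsPolyZ G) :
    Group.FG G ∧ SeparatesPowers G := by
  obtain ⟨n, c, h0, hlast, hstep⟩ := hG
  have key : ∀ i : Fin (n + 1), Group.FG (c i) ∧ SeparatesPowers (c i) := by
    intro i
    induction i using Fin.induction with
    | zero =>
      rw [h0]
      refine ⟨inferInstance, fun g hg => absurd ?_ hg⟩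
      exact isOfFinOrder_of_finite g
    | succ i ih =>
      obtain ⟨hle, f, hf, hker⟩ := hstep i
      let e : c i.castSucc ≃* f.ker :=
        (Subgroup.subgroupOfEquivOfLe hle).symm.trans (MulEquiv.subgroupCongr hker.symm)
      have := ih.1
      have : Group.FG f.ker := Group.fg_of_surjective (f := e.toMonoidHom) e.surjective
      exact ⟨Group.FG.of_ker_int f hf, SeparatesPowers.of_ker_int f hf (ih.2.of_mulEquiv e)⟩
  have h := key (Fin.last n)
  rw [hlast] at h
  have := h.1
  exact ⟨Group.fg_of_surjective (f := (Subgroup.topEquiv (G := G)).toMonoidHom)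
    Subgroup.topEquiv.surjective, h.2.of_mulEquiv Subgroup.topEquiv⟩

theorem SeparatesPowers.dvd_of_map_zpow_eq {G : Type*} [Group G] [Group.FG G]
    (hG : SeparatesPowers G) (φ : G ≃* G) {g : G} (hg : ¬ IsOfFinOrder g) {a b : ℤ}
    (ha : a ≠ 0) (hab : φ (g ^ a) = g ^ b) : a ∣ b := by
  obtain ⟨N, hN, hNdvd⟩ := hG g hg a.natAbs (Int.natAbs_ne_zero.mpr ha)
  obtain ⟨K, hK, hKfin, hKN⟩ := N.exists_characteristic_finiteIndex_le
  let r : ℕ := orderOf (g : G ⧸ K)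
  have hr (n : ℤ) : g ^ n ∈ K ↔ (r : ℤ) ∣ n := by
    rw [orderOf_dvd_iff_zpow_eq_one, ← QuotientGroup.mk_zpow, QuotientGroup.eq_one_iff]
  have hr0 : (r : ℤ) ≠ 0 := by
    exact_mod_cast (isOfFinOrder_of_finite (g : G ⧸ K)).orderOf_pos.ne'
  obtain ⟨k, hk⟩ : a ∣ (r : ℤ) := Int.natAbs_dvd.mp (hNdvd r (hKN ((hr r).mpr dvd_rfl)))
  have hgk : g ^ (b * k) ∈ K := by
    have h : g ^ (a * k) ∈ K := (hr _).mpr hk.dvd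
    have h' : φ (g ^ (a * k)) ∈ K := Subgroup.characteristic_iff_le_comap.mp hK φ h
    rwa [zpow_mul, map_zpow, hab, ← zpow_mul] at h'
  have hdvd : a * k ∣ b * k := hk ▸ (hr _).mp hgk
  exact Int.dvd_of_mul_dvd_mul_right (right_ne_zero_of_mul (hk ▸ hr0)) hdvd

theorem virtually_polyZ_property_A
    (G : Type*) [Group G] (hG : IsVirtuallyPolyZ G)
    (φ : G ≃* G) (g : G) (hg : ∀ k : ℤ, k ≠ 0 → g ^ k ≠ 1)
    (a b : ℤ) (hab : φ (g ^ a) = g ^ b) :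
    a = b ∨ a = -b := by
  obtain ⟨H, hH, hpoly⟩ := hG
  obtain ⟨hfg, hsep⟩ := hpoly.fg_and_separatesPowers
  have := Group.FG.of_finiteIndex H
  have hsepG := hsep.of_finiteIndex H
  have hinf : ¬ IsOfFinOrder g := fun h => by
    obtain ⟨n, hn, hn1⟩ := isOfFinOrder_iff_zpow_eq_one.mp h
    exact hg n hn hn1
  have hba : φ.symm (g ^ b) = g ^ a := by rw [← hab, φ.symm_apply_apply]
  rcases eq_or_ne a 0 with rfl | ha
  · left
    by_contra hb
    exact hg b (Ne.symm hb) (by simpa using hab.symm)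
  rcases eq_or_ne b 0 with rfl | hb
  · exact absurd (by simpa using hba.symm) (hg a ha)
  exact Int.natAbs_eq_natAbs_iff.mp (Int.natAbs_eq_of_dvd_dvd
    (hsepG.dvd_of_map_zpow_eq φ hinf ha hab) (hsepG.dvd_of_map_zpow_eq φ.symm hinf hb hba))
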